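/- Suppose the hazard function λ of X satisfies λ(x)/Λ(x) ≤ β₀ x^{-1} and x λ(x) → ∞ (Assumptions B1, B2). Then X is subexponential. More precisely, Pitman's criterion applies: ∫_{b₀}^∞ exp(x λ(x) − Λ(x)) dx ≤ ∫_{b₀}^∞ e^{(β₀−1)Λ(x)} dx < ∞, since the combination of B1 and B2 gives e^{(β₀−1)Λ(x)} = O(x^{-2}). -/

import Mathlib

open MeasureTheory Real Filter

section HazardFunction

variable {b β : ℝ} {Λ lam : ℝ → ℝ}

lemma antitoneOn_cumHazard_mul_rpow_neg {γ : ℝ} (hb : 0 < b) (hγ : β ≤ γ)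
    (hpos : ∀ x, 0 ≤ Λ x) (hderiv : ∀ x ≥ b, HasDerivAt Λ (lam x) x)
    (hle : ∀ x ≥ b, x * lam x ≤ β * Λ x) :
    AntitoneOn (fun x => Λ x * x ^ (-γ)) (Set.Ici b) := by
  have hd : ∀ x ≥ b, HasDerivAt (fun x => Λ x * x ^ (-γ))
      (lam x * x ^ (-γ) + Λ x * (-γ * x ^ (-γ - 1))) x := fun x hx =>
    (hderiv x hx).mul (hasDerivAt_rpow_const (Or.inl (hb.trans_le hx).ne'))
  refine antitoneOn_of_hasDerivWithinAt_nonpos (convex_Ici b)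
    (fun x hx => (hd x hx).continuousAt.continuousWithinAt)
    (fun x hx => (hd x (interior_subset hx)).hasDerivWithinAt) fun x hx => ?_
  have hxb : b ≤ x := interior_subset hx
  have hx0 : 0 < x := hb.trans_le hxb
  have hsplit : x ^ (-γ) = x * x ^ (-γ - 1) := by
    rw [rpow_sub_one hx0.ne']; field_simp
  have hfac : lam x * x ^ (-γ) + Λ x * (-γ * x ^ (-γ - 1))
      = (x * lam x - γ * Λ x) * x ^ (-γ - 1) := by rw [hsplit]; ring
  rw [hfac]
  refine mul_nonpos_of_nonpos_of_nonneg ?_ (rpow_nonneg hx0.le _)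
  nlinarith [hle x hxb, hpos x]

lemma cumHazard_sub_le (hb : 0 < b) (hβ0 : 0 ≤ β) (hβ1 : β ≤ 1)
    (hpos : ∀ x, 0 ≤ Λ x) (hderiv : ∀ x ≥ b, HasDerivAt Λ (lam x) x)
    (hle : ∀ x ≥ b, x * lam x ≤ β * Λ x) {x u : ℝ} (hx : b ≤ x) (hxu : 2 * x ≤ u) :
    Λ u - Λ (u - x) ≤ β * Λ x := by
  have hx0 : 0 < x := hb.trans_le hx
  have hanti := antitoneOn_cumHazard_mul_rpow_neg hb hβ1 hpos hderiv hle
  have hlam : ∀ y ≥ x, lam y ≤ β * Λ x / x := fun y hy => by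
    have hy0 : 0 < y := hx0.trans_le hy
    have h1 := hanti hx (hx.trans hy) hy
    simp only [rpow_neg_one, ← div_eq_mul_inv] at h1
    calc lam y ≤ β * Λ y / y := by
          rw [le_div_iff₀ hy0, mul_comm]; exact hle y (hx.trans hy)
      _ = β * (Λ y / y) := mul_div_assoc _ _ _
      _ ≤ β * (Λ x / x) := mul_le_mul_of_nonneg_left h1 hβ0
      _ = β * Λ x / x := (mul_div_assoc _ _ _).symm
  have hmv := (convex_Icc (u - x) u).image_sub_le_mul_sub_of_deriv_le (f := Λ)
    (C := β * Λ x / x)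
    (fun y hy => (hderiv y (by linarith [hy.1])).continuousAt.continuousWithinAt)
    (fun y hy => (hderiv y (by
      linarith [(interior_subset hy).1])).differentiableAt.differentiableWithinAt)
    (fun y hy => by
      have hy' := (interior_subset hy).1
      rw [(hderiv y (by linarith)).deriv]
      exact hlam y (by linarith))
    (u - x) ⟨le_rfl, by linarith⟩ u ⟨by linarith, le_rfl⟩ (by linarith)
  calc Λ u - Λ (u - x) ≤ β * Λ x / x * (u - (u - x)) := hmv
    _ = β * Λ x := by field_simp; ring

lemma tendsto_hazard_zero (hb : 0 < b) (hβ0 : 0 ≤ β) (hβ1 : β < 1)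
    (hpos : ∀ x, 0 ≤ Λ x) (hderiv : ∀ x ≥ b, HasDerivAt Λ (lam x) x)
    (hle : ∀ x ≥ b, x * lam x ≤ β * Λ x) (hlam : ∀ x ≥ b, 0 ≤ lam x) :
    Tendsto lam atTop (nhds 0) := by
  have hanti := antitoneOn_cumHazard_mul_rpow_neg hb le_rfl hpos hderiv hle
  have hlim : Tendsto (fun y : ℝ => β * (Λ b * b ^ (-β)) * y ^ (-(1 - β))) atTop (nhds 0) := by
    simpa using (tendsto_rpow_neg_atTop (sub_pos.2 hβ1)).const_mul (β * (Λ b * b ^ (-β)))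
  refine squeeze_zero' ((eventually_ge_atTop b).mono hlam) ?_ hlim
  filter_upwards [eventually_ge_atTop b] with y hy
  have hy0 : 0 < y := hb.trans_le hy
  have h1 : Λ y * y ^ (-β) ≤ Λ b * b ^ (-β) := hanti Set.self_mem_Ici hy hy
  have hsplit : y ^ (-(1 - β)) * y ^ (-β) = y⁻¹ := by
    rw [← rpow_add hy0, ← rpow_neg_one]; ring_nf
  have h2 : y ^ (-(1 - β)) = y⁻¹ * y ^ β := by
    rw [← hsplit, mul_assoc, ← rpow_add hy0]; simp
  have h3 : Λ y ≤ Λ b * b ^ (-β) * y ^ β := by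
    rwa [rpow_neg hy0.le, ← div_eq_mul_inv, div_le_iff₀ (rpow_pos_of_pos hy0 _)] at h1
  rw [h2]
  calc lam y ≤ β * Λ y / y := by rw [le_div_iff₀ hy0, mul_comm]; exact hle y hy
    _ ≤ β * (Λ b * b ^ (-β) * y ^ β) / y := by gcongr
    _ = β * (Λ b * b ^ (-β)) * (y⁻¹ * y ^ β) := by ring

lemma tendsto_cumHazard_sub_zero (hderiv : ∀ x ≥ b, HasDerivAt Λ (lam x) x)
    (hlim : Tendsto lam atTop (nhds 0)) (x : ℝ) :
    Tendsto (fun u => Λ u - Λ (u - x)) atTop (nhds 0) := by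
  rw [Metric.tendsto_atTop]
  intro ε hε
  have hδ : 0 < ε / (|x| + 1) := by positivity
  obtain ⟨N, hN⟩ := Metric.tendsto_atTop.1 hlim _ hδ
  refine ⟨max N b + |x|, fun u hu => ?_⟩
  have hmv := (convex_Ici (max N b)).norm_image_sub_le_of_norm_hasDerivWithin_le
    (f := Λ) (f' := lam) (C := ε / (|x| + 1)) (x := u - x) (y := u)
    (fun y hy => (hderiv y (le_of_max_le_right hy)).hasDerivWithinAt)
    (fun y hy => by simpa using (hN y (le_of_max_le_left hy)).le)
    (Set.mem_Ici.2 (by linarith [le_abs_self x]))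
    (Set.mem_Ici.2 (by linarith [abs_nonneg x]))
  rw [Real.dist_eq, sub_zero]
  calc |Λ u - Λ (u - x)| ≤ ε / (|x| + 1) * |x| := by simpa using hmv
    _ < ε / (|x| + 1) * (|x| + 1) := mul_lt_mul_of_pos_left (lt_add_one _) hδ
    _ = ε := by field_simp

lemma exists_mul_log_add_le_cumHazard (hderiv : ∀ x ≥ b, HasDerivAt Λ (lam x) x)
    (hB1 : Tendsto (fun x => x * lam x) atTop atTop) (K : ℝ) :
    ∃ N c : ℝ, b ≤ N ∧ 0 < N ∧ ∀ x ≥ N, K * log x + c ≤ Λ x := by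
  obtain ⟨M, hM⟩ := eventually_atTop.1 (hB1.eventually_ge_atTop K)
  set N := max (max M b) 1
  have hNM : M ≤ N := (le_max_left M b).trans (le_max_left _ _)
  have hNb : b ≤ N := (le_max_right M b).trans (le_max_left _ _)
  have hN0 : 0 < N := one_pos.trans_le (le_max_right _ _)
  have hd : ∀ x ≥ N, HasDerivAt (fun x => Λ x - K * log x) (lam x - K * x⁻¹) x := fun x hx =>
    (hderiv x (hNb.trans hx)).sub ((hasDerivAt_log (hN0.trans_le hx).ne').const_mul K)
  have hmono : MonotoneOn (fun x => Λ x - K * log x) (Set.Ici N) := by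
    refine monotoneOn_of_hasDerivWithinAt_nonneg (convex_Ici N)
      (fun x hx => (hd x hx).continuousAt.continuousWithinAt)
      (fun x hx => (hd x (interior_subset hx)).hasDerivWithinAt) fun x hx => ?_
    have hxN : N ≤ x := interior_subset hx
    have hx0 := hN0.trans_le hxN
    have h := hM x (hNM.trans hxN)
    rw [sub_nonneg, ← div_eq_mul_inv, div_le_iff₀ hx0, mul_comm]
    exact h
  refine ⟨N, Λ N - K * log N, hNb, hN0, fun x hx => ?_⟩
  have h : Λ N - K * log N ≤ Λ x - K * log x := hmono Set.self_mem_Ici hx hx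
  linarith

lemma tendsto_cumHazard_atTop (hderiv : ∀ x ≥ b, HasDerivAt Λ (lam x) x)
    (hB1 : Tendsto (fun x => x * lam x) atTop atTop) : Tendsto Λ atTop atTop := by
  obtain ⟨N, c, -, -, h⟩ := exists_mul_log_add_le_cumHazard hderiv hB1 1
  refine tendsto_atTop_mono' _ ((eventually_ge_atTop N).mono h) ?_
  simpa using tendsto_atTop_add_const_right _ c tendsto_log_atTop

lemma integrableOn_exp_neg_mul_cumHazard {r : ℝ} (hr : r < 0)
    (hderiv : ∀ x ≥ b, HasDerivAt Λ (lam x) x)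
    (hB1 : Tendsto (fun x => x * lam x) atTop atTop) :
    IntegrableOn (fun x => exp (r * Λ x)) (Set.Ioi b) := by
  obtain ⟨N, c, hbN, hN0, h⟩ := exists_mul_log_add_le_cumHazard hderiv hB1 (2 / -r)
  have hcont : ContinuousOn (fun x => exp (r * Λ x)) (Set.Ici b) := fun x hx =>
    ((hderiv x hx).continuousAt.const_mul r).rexp.continuousWithinAt
  rw [← Set.Ioc_union_Ioi_eq_Ioi hbN, integrableOn_union]
  constructor
  · exact ((hcont.mono Set.Icc_subset_Ici_self).integrableOn_Icc).mono_set Set.Ioc_subset_Icc_self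
  · refine Integrable.mono' (g := fun x => exp (r * c) * x ^ (-2 : ℝ))
      ((integrableOn_Ioi_rpow_of_lt (by norm_num) hN0).const_mul _)
      ((hcont.mono (Set.Ioi_subset_Ici hbN)).aestronglyMeasurable measurableSet_Ioi) ?_
    refine (ae_restrict_iff' measurableSet_Ioi).2 (Eventually.of_forall fun x hx => ?_)
    have hx0 : 0 < x := hN0.trans hx
    rw [norm_of_nonneg (exp_pos _).le, rpow_def_of_pos hx0, ← exp_add, exp_le_exp]
    calc r * Λ x ≤ r * (2 / -r * log x + c) := mul_le_mul_of_nonpos_left (h x hx.le) hr.le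
      _ = r * c + log x * -2 := by field_simp [hr.ne]; ring

/-- The survival function evaluated at its own random variable, raised to a power above `-1`,
is integrable. -/
lemma integrable_exp_mul_cumHazard_max {μ : Measure ℝ} [IsProbabilityMeasure μ]
    (htail : ∀ x, μ (Set.Ioi x) = ENNReal.ofReal (exp (-(Λ x))))
    (hβ0 : 0 < β) (hβ1 : β < 1) (hmono : Monotone Λ)
    (hcont : ContinuousOn Λ (Set.Ici b)) (htop : Tendsto Λ atTop atTop) :
    Integrable (fun x => exp (β * Λ (max x b))) μ := by
  have hm : Measurable fun x => exp (β * Λ (max x b)) :=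
    ((hmono.measurable.comp (measurable_id.max measurable_const)).const_mul β).exp
  refine ⟨hm.aestronglyMeasurable, ?_⟩
  rw [hasFiniteIntegral_iff_ofReal (Eventually.of_forall fun x => (exp_pos _).le),
    lintegral_eq_lintegral_meas_lt μ (Eventually.of_forall fun x => (exp_pos _).le) hm.aemeasurable]
  set T := exp (β * Λ b)
  have hT : 0 < T := exp_pos _
  rw [← Set.Ioc_union_Ioi_eq_Ioi hT.le]
  refine (lintegral_union_le _ _ _).trans_lt (ENNReal.add_lt_top.2 ⟨?_, ?_⟩)
  · calc ∫⁻ t in Set.Ioc 0 T, μ {a | t < exp (β * Λ (max a b))}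
        ≤ ∫⁻ _ in Set.Ioc 0 T, 1 := lintegral_mono fun t => prob_le_one
      _ < ⊤ := by simp
  · have hint : IntegrableOn (fun t : ℝ => t ^ (-(1 / β))) (Set.Ioi T) :=
      integrableOn_Ioi_rpow_of_lt (neg_lt_neg ((one_lt_div hβ0).2 hβ1)) hT
    refine lt_of_le_of_lt (setLIntegral_mono' measurableSet_Ioi fun t ht => ?_)
      hint.lintegral_lt_top
    have ht0 : 0 < t := hT.trans ht
    have hs : Λ b ≤ log t / β := by
      rw [le_div_iff₀ hβ0, le_log_iff_exp_le ht0, mul_comm]; exact ht.le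
    obtain ⟨z, hz⟩ : ∃ z, Λ z = log t / β := by
      obtain ⟨c, hbc, hc⟩ := (htop.eventually_ge_atTop (log t / β)).and
        (eventually_ge_atTop b) |>.exists.imp fun c h => And.symm h
      obtain ⟨z, -, hz⟩ := intermediate_value_Icc hbc
        (hcont.mono Set.Icc_subset_Ici_self) ⟨hs, hc⟩
      exact ⟨z, hz⟩
    have hsub : {a | t < exp (β * Λ (max a b))} ⊆ Set.Ioi z := fun a ha => by
      have h1 : Λ z < Λ (max a b) := by
        rw [hz, div_lt_iff₀ hβ0, mul_comm]; exact (log_lt_iff_lt_exp ht0).2 ha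
      have h2 : Λ b ≤ Λ z := hs.trans hz.ge
      by_contra hza
      have h3 : a ≤ z := not_lt.1 hza
      rcases max_cases a b with h | h
      · exact absurd (hmono h3) (by rw [← h.1]; exact not_le.2 h1)
      · rw [h.1] at h1; linarith
    calc μ {a | t < exp (β * Λ (max a b))} ≤ μ (Set.Ioi z) := measure_mono hsub
      _ = ENNReal.ofReal (t ^ (-(1 / β))) := by
        rw [htail, hz, rpow_def_of_pos ht0]; congr 2; ring

end HazardFunction

/-- `P(X₁ + X₂ > u)` split according to which of the summands exceeds `u / 2`. -/
lemma prod_self_sum_tail_eq (μ : Measure ℝ) [IsProbabilityMeasure μ] (u : ℝ) :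
    ((μ.prod μ) {p : ℝ × ℝ | u < p.1 + p.2}).toReal
      = 2 * (∫ x, (Set.Iic (u / 2)).indicator (fun x => (μ (Set.Ioi (u - x))).toReal) x ∂μ)
        + (μ (Set.Ioi (u / 2))).toReal ^ 2 := by
  set A : Set (ℝ × ℝ) := {p | u < p.1 + p.2 ∧ p.1 ≤ u / 2} with hA
  set B : Set (ℝ × ℝ) := {p | u < p.1 + p.2 ∧ p.2 ≤ u / 2} with hB
  set C : Set (ℝ × ℝ) := Set.Ioi (u / 2) ×ˢ Set.Ioi (u / 2) with hC
  have hS : MeasurableSet {p : ℝ × ℝ | u < p.1 + p.2} :=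
    measurableSet_lt measurable_const (measurable_fst.add measurable_snd)
  have hAm : MeasurableSet A := hS.inter (measurableSet_le measurable_fst measurable_const)
  have hBm : MeasurableSet B := hS.inter (measurableSet_le measurable_snd measurable_const)
  have hCm : MeasurableSet C := measurableSet_Ioi.prod measurableSet_Ioi
  have hdecomp : {p : ℝ × ℝ | u < p.1 + p.2} = (A ∪ B) ∪ C := by
    ext ⟨x, y⟩
    simp only [hA, hB, hC, Set.mem_ofPred_eq, Set.mem_union, Set.mem_prod, Set.mem_Ioi]
    constructor
    · intro h
      by_cases hx : x ≤ u / 2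
      · exact Or.inl (Or.inl ⟨h, hx⟩)
      · by_cases hy : y ≤ u / 2
        · exact Or.inl (Or.inr ⟨h, hy⟩)
        · exact Or.inr ⟨not_le.1 hx, not_le.1 hy⟩
    · rintro ((h | h) | h)
      · exact h.1
      · exact h.1
      · linarith [h.1, h.2]
  have hAB : Disjoint A B := Set.disjoint_left.2 fun p hp hq => by
    have h1 := hp.1
    linarith [hp.2, hq.2]
  have hABC : Disjoint (A ∪ B) C := Set.disjoint_left.2 fun p hp hq => by
    rcases hp with hp | hp
    · exact absurd hp.2 (not_le.2 hq.1)
    · exact absurd hp.2 (not_le.2 hq.2)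
  have hslice : ∀ x, (μ (Prod.mk x ⁻¹' A)).toReal
      = (Set.Iic (u / 2)).indicator (fun x => (μ (Set.Ioi (u - x))).toReal) x := fun x => by
    by_cases hx : x ≤ u / 2
    · rw [Set.indicator_of_mem (Set.mem_Iic.2 hx)]
      congr 2
      ext y
      simp [hA, hx, sub_lt_iff_lt_add']
    · rw [Set.indicator_of_notMem (by simpa using hx)]
      simp [hA, hx]
  have hAval : ((μ.prod μ) A).toReal
      = ∫ x, (Set.Iic (u / 2)).indicator (fun x => (μ (Set.Ioi (u - x))).toReal) x ∂μ := by
    rw [Measure.prod_apply hAm, ← integral_toReal (measurable_measure_prodMk_left hAm).aemeasurable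
      (Eventually.of_forall fun x => measure_lt_top _ _)]
    exact integral_congr_ae (Eventually.of_forall hslice)
  have hBA : (μ.prod μ) B = (μ.prod μ) A := by
    rw [Measure.prod_apply_symm hBm, Measure.prod_apply hAm]
    refine lintegral_congr fun x => ?_
    congr 1
    ext y
    simp [hA, hB, add_comm]
  rw [hdecomp, measure_union hABC hCm, measure_union hAB hBm, hBA,
    ENNReal.toReal_add (by finiteness) (by finiteness),
    ENNReal.toReal_add (by finiteness) (by finiteness), hAval, hC, Measure.prod_prod,
    ENNReal.toReal_mul]
  ring

/-- Subexponentiality via Pitman's criterion (Lemma 2.6): under Assumptions B1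
and B2, `∫_{b₀}^∞ e^{xλ(x)-Λ(x)} dx ≤ ∫_{b₀}^∞ e^{(β₀-1)Λ(x)} dx < ∞`, and `X`
is subexponential: `P(X₁+X₂ > u)/P(X > u) → 2`. -/
theorem stmt13 (b₀ β₀ : ℝ) (hb₀ : 0 < b₀) (hβ₀ : β₀ ∈ Set.Ioo (0:ℝ) 1)
    (μ : Measure ℝ) [IsProbabilityMeasure μ]
    (Λ lam : ℝ → ℝ)
    (htail : ∀ x, (μ (Set.Ioi x)).toReal = Real.exp (-(Λ x)))
    (hderiv : ∀ x ≥ b₀, HasDerivAt Λ (lam x) x)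
    (hB1 : Tendsto (fun x => x * lam x) atTop atTop)
    (hB2 : ∀ x ≥ b₀, lam x / Λ x ≤ β₀ / x) :
    IntegrableOn (fun x => Real.exp ((β₀ - 1) * Λ x)) (Set.Ioi b₀) ∧
    IntegrableOn (fun x => Real.exp (x * lam x - Λ x)) (Set.Ioi b₀) ∧
    (∫ x in Set.Ioi b₀, Real.exp (x * lam x - Λ x))
      ≤ (∫ x in Set.Ioi b₀, Real.exp ((β₀ - 1) * Λ x)) ∧
    Tendsto (fun u => ((μ.prod μ) {p : ℝ × ℝ | u < p.1 + p.2}).toReal /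
        (μ (Set.Ioi u)).toReal) atTop (nhds 2) := by
  obtain ⟨hβ0, hβ1⟩ := hβ₀
  have hpos : ∀ x, 0 ≤ Λ x := fun x => by
    have h : exp (-(Λ x)) ≤ 1 := htail x ▸ ENNReal.toReal_le_of_le_ofReal one_pos.le
      (by simpa using prob_le_one)
    simpa using h
  have hmono : Monotone Λ := fun x y hxy => by
    have h : exp (-(Λ y)) ≤ exp (-(Λ x)) := by
      rw [← htail, ← htail]
      exact ENNReal.toReal_mono (by finiteness) (measure_mono (Set.Ioi_subset_Ioi hxy))
    simpa using h
  have hlam : ∀ x ≥ b₀, 0 ≤ lam x := fun x hx => by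
    rw [← (hderiv x hx).deriv]; exact hmono.deriv_nonneg
  have hle : ∀ x ≥ b₀, x * lam x ≤ β₀ * Λ x := fun x hx => by
    have hx0 : 0 < x := hb₀.trans_le hx
    rcases (hpos x).eq_or_lt with h0 | h0
    · have hmin : IsLocalMin Λ x := Eventually.of_forall fun y => h0 ▸ hpos y
      rw [hmin.hasDerivAt_eq_zero (hderiv x hx), ← h0]; simp
    · have h := hB2 x hx
      rw [div_le_div_iff₀ h0 hx0] at h
      linarith
  have htop : Tendsto Λ atTop atTop := tendsto_cumHazard_atTop hderiv hB1
  have hint : IntegrableOn (fun x => exp ((β₀ - 1) * Λ x)) (Set.Ioi b₀) :=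
    integrableOn_exp_neg_mul_cumHazard (by linarith) hderiv hB1
  have hexp_le : ∀ x ∈ Set.Ioi b₀, exp (x * lam x - Λ x) ≤ exp ((β₀ - 1) * Λ x) := fun x hx => by
    rw [exp_le_exp]; linarith [hle x (le_of_lt hx)]
  have hint' : IntegrableOn (fun x => exp (x * lam x - Λ x)) (Set.Ioi b₀) := by
    refine Integrable.mono' hint ?_ ((ae_restrict_iff' measurableSet_Ioi).2
      (Eventually.of_forall fun x hx => ?_))
    · have hm : Measurable fun x => exp (x * deriv Λ x - Λ x) :=
        ((measurable_id.mul (measurable_deriv Λ)).sub hmono.measurable).exp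
      refine hm.aestronglyMeasurable.congr ((ae_restrict_iff' measurableSet_Ioi).2
        (Eventually.of_forall fun x hx => ?_))
      simp only [(hderiv x (le_of_lt hx)).deriv]
    · rw [norm_of_nonneg (exp_pos _).le]; exact hexp_le x hx
  refine ⟨hint, hint', setIntegral_mono_on hint' hint measurableSet_Ioi hexp_le, ?_⟩
  have hsplit : ∀ u, ((μ.prod μ) {p : ℝ × ℝ | u < p.1 + p.2}).toReal / (μ (Set.Ioi u)).toReal
      = 2 * (∫ x, (Set.Iic (u / 2)).indicator (fun x => exp (Λ u - Λ (u - x))) x ∂μ)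
        + exp (Λ u - 2 * Λ (u / 2)) := fun u => by
    have hind : ∀ x, (Set.Iic (u / 2)).indicator (fun x => exp (Λ u - Λ (u - x))) x
        = exp (Λ u) * (Set.Iic (u / 2)).indicator (fun x => exp (-(Λ (u - x)))) x := fun x => by
      by_cases hx : x ∈ Set.Iic (u / 2) <;> simp [hx, sub_eq_add_neg, exp_add]
    simp only [prod_self_sum_tail_eq, htail, hind, integral_const_mul]
    rw [sub_eq_add_neg, exp_add, exp_neg (Λ u), div_inv_eq_mul, ← exp_nat_mul]
    push_cast
    ring_nf
  have hlongtail := tendsto_cumHazard_sub_zero hderiv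
    (tendsto_hazard_zero hb₀ hβ0.le hβ1 hpos hderiv hle hlam)
  have hdom : Tendsto
      (fun u => ∫ x, (Set.Iic (u / 2)).indicator (fun x => exp (Λ u - Λ (u - x))) x ∂μ)
      atTop (nhds (∫ _, (1 : ℝ) ∂μ)) := by
    have htail' : ∀ x, μ (Set.Ioi x) = ENNReal.ofReal (exp (-(Λ x))) := fun x => by
      rw [← htail, ENNReal.ofReal_toReal (by finiteness)]
    have hcont : ContinuousOn Λ (Set.Ici b₀) := fun x hx =>
      (hderiv x hx).continuousAt.continuousWithinAt
    refine tendsto_integral_filter_of_dominated_convergence _ (Eventually.of_forall fun u => ?_) ?_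
      (integrable_exp_mul_cumHazard_max htail' hβ0 hβ1 hmono hcont htop)
      (Eventually.of_forall fun x => ?_)
    · exact ((measurable_const.sub (hmono.measurable.comp
        (measurable_const.sub measurable_id))).exp.indicator measurableSet_Iic).aestronglyMeasurable
    · filter_upwards [eventually_ge_atTop (2 * b₀)] with u hu
      refine Eventually.of_forall fun x => ?_
      by_cases hx : x ∈ Set.Iic (u / 2)
      · rw [Set.indicator_of_mem hx, norm_of_nonneg (exp_pos _).le, exp_le_exp]
        have hmax : 2 * max x b₀ ≤ u := by
          have h : max x b₀ ≤ u / 2 := max_le hx (by linarith)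
          linarith
        have h1 := cumHazard_sub_le hb₀ hβ0.le hβ1.le hpos hderiv hle (le_max_right x b₀) hmax
        have h2 : Λ (u - max x b₀) ≤ Λ (u - x) := hmono (by linarith [le_max_left x b₀])
        linarith
      · rw [Set.indicator_of_notMem hx, norm_zero]; exact (exp_pos _).le
    · have h : Tendsto (fun u => exp (Λ u - Λ (u - x))) atTop (nhds 1) := by
        simpa using (hlongtail x).rexp
      refine h.congr' ?_
      filter_upwards [eventually_ge_atTop (2 * x)] with u hu
      rw [Set.indicator_of_mem (Set.mem_Iic.2 (by linarith))]
  have hboth : Tendsto (fun u => exp (Λ u - 2 * Λ (u / 2))) atTop (nhds 0) := by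
    have hlim : Tendsto (fun u => exp ((β₀ - 1) * Λ (u / 2))) atTop (nhds 0) :=
      tendsto_exp_atBot.comp ((htop.comp (tendsto_id.atTop_div_const two_pos)).const_mul_atTop_of_neg
        (by linarith))
    refine squeeze_zero' (Eventually.of_forall fun u => (exp_pos _).le) ?_ hlim
    filter_upwards [eventually_ge_atTop (2 * b₀)] with u hu
    have h := cumHazard_sub_le hb₀ hβ0.le hβ1.le hpos hderiv hle (x := u / 2) (u := u)
      (by linarith) (by linarith)
    rw [sub_half] at h
    rw [exp_le_exp]; linarith
  simp only [hsplit]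
  simpa using (hdom.const_mul 2).add hboth
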